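/- For every p ∈ ℤ there is an isomorphism of abelian groups ∏_n H^n(C, H_{n−p}(G)) ≅ H^p(C,G) (Brown's theorem: the cohomology of C with coefficients in the chain complex G is the product of the cohomologies of C with coefficients in the homology groups of G). -/

import Mathlib

noncomputable section

/-- Transport along an equality of indices, as a homomorphism of the groups in a family. -/
def castHom (F : ℤ → Type*) [∀ n, AddCommGroup (F n)] {a b : ℤ} (h : a = b) :
    F a →+ F b := by subst h; exact AddMonoidHom.id (F a)

/-- The coboundary `δ^p` on `p`-maps between two chain complexes of abelian groups:
`(δ^p f)_n = f_{n-1} ∘ ∂_n - (-1)^p ∂'_{n-p} ∘ f_n`. -/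
def homDelta (C C' : ℤ → Type*) [∀ n, AddCommGroup (C n)] [∀ n, AddCommGroup (C' n)]
    (d : ∀ n : ℤ, C n →+ C (n - 1)) (d' : ∀ n : ℤ, C' n →+ C' (n - 1))
    (p : ℤ) (f : ∀ n : ℤ, C n →+ C' (n - p)) (n : ℤ) : C n →+ C' (n - (p + 1)) :=
  (castHom C' (show n - 1 - p = n - (p + 1) by ring)).comp ((f (n - 1)).comp (d n))
    - (p.negOnePow : ℤ) •
        (castHom C' (show n - p - 1 = n - (p + 1) by ring)).comp ((d' (n - p)).comp (f n))

/-- The `n`-cycles `ker(∂_n)` of a chain complex of abelian groups. -/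
def cyclesSub (G : ℤ → Type*) [∀ n, AddCommGroup (G n)]
    (dG : ∀ n : ℤ, G n →+ G (n - 1)) (n : ℤ) : AddSubgroup (G n) :=
  (dG n).ker

/-- The `n`-boundaries `im(∂_{n+1})` of a chain complex of abelian groups. -/
def boundariesSub (G : ℤ → Type*) [∀ n, AddCommGroup (G n)]
    (dG : ∀ n : ℤ, G n →+ G (n - 1)) (n : ℤ) : AddSubgroup (G n) :=
  ((dG (n + 1)).range).map (castHom G (show n + 1 - 1 = n by ring))

/-- The homology group `H_n(G) = ker(∂_n)/im(∂_{n+1})`. -/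
abbrev homologyGrp (G : ℤ → Type*) [∀ n, AddCommGroup (G n)]
    (dG : ∀ n : ℤ, G n →+ G (n - 1)) (n : ℤ) : Type _ :=
  ↥(cyclesSub G dG n) ⧸ (boundariesSub G dG n).addSubgroupOf (cyclesSub G dG n)

/-- The canonical projection `π_n : ker(∂_n) → H_n(G)`. -/
def homologyProj (G : ℤ → Type*) [∀ n, AddCommGroup (G n)]
    (dG : ∀ n : ℤ, G n →+ G (n - 1)) (n : ℤ) :
    ↥(cyclesSub G dG n) →+ homologyGrp G dG n :=
  QuotientAddGroup.mk' ((boundariesSub G dG n).addSubgroupOf (cyclesSub G dG n))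

/-- The coboundary `d_n : Hom(C_n, M) → Hom(C_{n+1}, M)`, `d_n(h) = h ∘ ∂^C_{n+1}`. -/
def dualD (C : ℤ → Type*) [∀ n, AddCommGroup (C n)] (dC : ∀ n : ℤ, C n →+ C (n - 1))
    (M : Type*) [AddCommGroup M] (n : ℤ) : (C n →+ M) →+ (C (n + 1) →+ M) where
  toFun h := h.comp ((castHom C (show n + 1 - 1 = n by ring)).comp (dC (n + 1)))
  map_zero' := by ext x; simp
  map_add' h h' := by ext x; simp

/-- The `n`-cocycles of `C` with coefficients in `M`. -/
def cocyclesSub (C : ℤ → Type*) [∀ n, AddCommGroup (C n)] (dC : ∀ n : ℤ, C n →+ C (n - 1))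
    (M : Type*) [AddCommGroup M] (n : ℤ) : AddSubgroup (C n →+ M) :=
  (dualD C dC M n).ker

/-- The `n`-coboundaries of `C` with coefficients in `M`. -/
def coboundariesSub (C : ℤ → Type*) [∀ n, AddCommGroup (C n)]
    (dC : ∀ n : ℤ, C n →+ C (n - 1)) (M : Type*) [AddCommGroup M] (n : ℤ) :
    AddSubgroup (C n →+ M) :=
  ((dualD C dC M (n - 1)).range).map
    (castHom (fun k => C k →+ M) (show n - 1 + 1 = n by ring))

/-- The cohomology `H^n(C,M) = ker(d_n)/im(d_{n-1})` of `C` with coefficients in `M`. -/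
abbrev cohomologyGrp (C : ℤ → Type*) [∀ n, AddCommGroup (C n)]
    (dC : ∀ n : ℤ, C n →+ C (n - 1)) (M : Type*) [AddCommGroup M] (n : ℤ) : Type _ :=
  ↥(cocyclesSub C dC M n) ⧸
    (coboundariesSub C dC M n).addSubgroupOf (cocyclesSub C dC M n)

/-- The coboundary `δ^p : hom(C,G)^p → hom(C,G)^{p+1}` as a group homomorphism. -/
def bigDelta (C G : ℤ → Type*) [∀ n, AddCommGroup (C n)] [∀ n, AddCommGroup (G n)]
    (dC : ∀ n : ℤ, C n →+ C (n - 1)) (dG : ∀ n : ℤ, G n →+ G (n - 1)) (p : ℤ) :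
    (∀ n : ℤ, C n →+ G (n - p)) →+ (∀ n : ℤ, C n →+ G (n - (p + 1))) where
  toFun f := homDelta C G dC dG p f
  map_zero' := by
    funext n; ext x
    simp [homDelta]
  map_add' f g := by
    funext n; ext x
    simp [homDelta]
    abel

/-- The cohomology `H^p(C,G) = ker(δ^p)/im(δ^{p-1})` of `C` with coefficients in the chain
complex `G`. -/
abbrev homComplexCohomology (C G : ℤ → Type*) [∀ n, AddCommGroup (C n)]
    [∀ n, AddCommGroup (G n)] (dC : ∀ n : ℤ, C n →+ C (n - 1))
    (dG : ∀ n : ℤ, G n →+ G (n - 1)) (p : ℤ) : Type _ :=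
  ↥((bigDelta C G dC dG p).ker) ⧸
    (((bigDelta C G dC dG (p - 1)).range).map
        (castHom (fun q => ∀ n : ℤ, C n →+ G (n - q)) (show p - 1 + 1 = p by ring))
      ).addSubgroupOf ((bigDelta C G dC dG p).ker)

theorem exists_lift_of_free {A M N : Type*} [AddCommGroup A] [AddCommGroup M] [AddCommGroup N]
    [Module.Free ℤ A] (φ : M →+ N) (θ : A →+ N) (h : ∀ x, ∃ m, φ m = θ x) :
    ∃ t : A →+ M, ∀ x, φ (t x) = θ x := by
  obtain ⟨t, ht⟩ := Module.projective_lifting_property φ.rangeRestrict.toIntLinearMap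
    (θ.codRestrict φ.range h).toIntLinearMap φ.rangeRestrict_surjective
  exact ⟨t.toAddMonoidHom, fun x => congrArg Subtype.val (LinearMap.congr_fun ht x)⟩

/-- A family of homomorphisms in degrees `n + 1` comes from a family in degrees `n`. -/
theorem exists_shift {X : ℤ → Type*} (f : ∀ n, X (n + 1)) :
    ∃ g : ∀ n, X n, ∀ n, g (n + 1) = f n := by
  refine ⟨fun n => cast (congrArg X (by ring)) (f (n - 1)), fun n => ?_⟩
  have key : ∀ m (h : m + 1 = n + 1), cast (congrArg X h) (f m) = f n := by
    intro m h
    obtain rfl : m = n := by omega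
    rfl
  exact key _ (by ring)

/-- A complex `C` whose cycles are retracts, a complex `G`, and resolutions `K n → F n → H n` of
groups `H n`, mapping to `G` through `π` and `lam` so that `H n` is the homology of `G`. -/
structure HomologyResolution (C G F K H : ℤ → Type*) [∀ n, AddCommGroup (C n)]
    [∀ n, AddCommGroup (G n)] [∀ n, AddCommGroup (F n)] [∀ n, AddCommGroup (K n)]
    [∀ n, AddCommGroup (H n)] where
  c : ∀ n, C (n + 1) →+ C n
  b : ∀ n, G (n + 1) →+ G n
  cyc : ∀ n, AddSubgroup (G n)
  r : ∀ n, C n →+ C n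
  π : ∀ n, F n →+ G n
  ι : ∀ n, K n →+ F n
  lam : ∀ n, K n →+ G (n + 1)
  ρ : ∀ n, F n →+ H n
  ε : ℤ
  ε_mul : ε * ε = 1
  mem_cyc : ∀ n x, x ∈ cyc (n + 1) ↔ b n x = 0
  b_mem : ∀ n x, b n x ∈ cyc n
  r_c : ∀ n x, r n (c n x) = c n x
  c_r : ∀ n x, c n (r (n + 1) x) = 0
  r_r : ∀ n x, r n (r n x) = r n x
  π_mem : ∀ n x, π n x ∈ cyc n
  exists_π : ∀ n, ∀ x ∈ cyc n, ∃ f, π n f = x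
  ι_inj : ∀ n, Function.Injective (ι n)
  b_lam : ∀ n k, b n (lam n k) = π n (ι n k)
  exists_ι : ∀ n f y, π n f = b n y → ∃ k, ι n k = f
  ρ_surj : ∀ n, Function.Surjective (ρ n)
  ρ_eq_zero : ∀ n f, ρ n f = 0 ↔ ∃ k, ι n k = f

namespace HomologyResolution

variable {C G F K H : ℤ → Type*} [∀ n, AddCommGroup (C n)]
    [∀ n, AddCommGroup (G n)] [∀ n, AddCommGroup (F n)] [∀ n, AddCommGroup (K n)]
    [∀ n, AddCommGroup (H n)] (D : HomologyResolution C G F K H)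

theorem c_c (n : ℤ) (x : C (n + 1 + 1)) : D.c n (D.c (n + 1) x) = 0 := by
  rw [← D.r_c (n + 1), D.c_r]

theorem b_π (n : ℤ) (f : F (n + 1)) : D.b n (D.π (n + 1) f) = 0 :=
  (D.mem_cyc _ _).1 (D.π_mem _ _)

theorem smul_ε {A : Type*} [AddCommGroup A] (x : A) : D.ε • D.ε • x = x := by
  rw [smul_smul, D.ε_mul, one_smul]

/-- `g` is the cochain with values in `G` assembled from `a` and `k`, where `k` expresses
`a ∘ ∂` through the relations `K`. -/
def Assembles (a : ∀ n, C n →+ F n) (k : ∀ n, C (n + 1) →+ K n) (g : ∀ n, C n →+ G n) : Prop :=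
  (∀ n x, D.ι n (k n x) = a n (D.c n x)) ∧
    ∀ n x, g (n + 1) x = D.π (n + 1) (a (n + 1) x) + D.ε • D.lam n (k n x)

/-- The cocycle condition for a cochain with values in `G`. -/
def IsCocycle (g : ∀ n, C n →+ G n) : Prop :=
  ∀ n x, g n (D.c n x) = D.ε • D.b n (g (n + 1) x)

theorem exists_assembles_of_isCocycle [∀ n, Module.Free ℤ (C n)] {g : ∀ n, C n →+ G n}
    (hg : D.IsCocycle g) : ∃ a k, D.Assembles a k g := by
  have hgr : ∀ n x, g n (D.r n x) ∈ D.cyc n := by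
    intro n x
    obtain ⟨m, rfl⟩ : ∃ m, n = m + 1 := ⟨n - 1, by ring⟩
    rw [D.mem_cyc, ← D.smul_ε (D.b m _), ← hg, D.c_r, map_zero, smul_zero]
  choose α hα using fun n => exists_lift_of_free (D.π n) ((g n).comp (D.r n))
    fun x => D.exists_π n _ (hgr n x)
  simp only [AddMonoidHom.comp_apply] at hα
  choose k hk using fun n => exists_lift_of_free (D.ι n) ((α n).comp (D.c n)) fun x =>
    D.exists_ι n _ (D.ε • g (n + 1) x) (by simp [hα, D.r_c, hg n])
  simp only [AddMonoidHom.comp_apply] at hk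
  have hkr : ∀ n x, k n (D.r (n + 1) x) = 0 := fun n x =>
    D.ι_inj n (by rw [hk, D.c_r, map_zero, map_zero])
  have hbr : ∀ n x, D.b n (g (n + 1) (D.r (n + 1) x)) = 0 := fun n x =>
    (D.mem_cyc n _).1 (hgr (n + 1) x)
  choose β' hβ' using fun n => exists_lift_of_free (D.π (n + 1))
    (g (n + 1) - (D.π (n + 1)).comp (α (n + 1)) - D.ε • (D.lam n).comp (k n)) fun x =>
    D.exists_π _ _ (by
      rw [D.mem_cyc]
      simp only [AddMonoidHom.sub_apply, AddMonoidHom.smul_apply, AddMonoidHom.comp_apply,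
        map_sub, map_zsmul, D.b_lam, hk, hα, D.r_c, hg n, D.smul_ε, hbr]
      simp)
  obtain ⟨β, hβ⟩ := exists_shift (X := fun n => C n →+ F n) β'
  refine ⟨fun n => α n + (β n - (β n).comp (D.r n)), k, fun n x => ?_, fun n x => ?_⟩
  · simp [hk, D.r_c]
  · simp [hβ, hβ', hα, D.r_r, hkr]
    abel

theorem Assembles.isCocycle {D : HomologyResolution C G F K H} {a : ∀ n, C n →+ F n}
    {k : ∀ n, C (n + 1) →+ K n} {g : ∀ n, C n →+ G n} (h : D.Assembles a k g) :
    D.IsCocycle g := by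
  intro n x
  obtain ⟨m, rfl⟩ : ∃ m, n = m + 1 := ⟨n - 1, by ring⟩
  have hk : k m (D.c (m + 1) x) = 0 := D.ι_inj m (by simp [h.1, D.c_c])
  rw [h.2, h.2, hk, map_add, map_zsmul, D.b_π, D.b_lam, h.1, zero_add, D.smul_ε]
  simp

theorem exists_assembles_of_comp_eq_zero [∀ n, Module.Free ℤ (C n)] (u : ∀ n, C n →+ H n)
    (hu : ∀ n x, u n (D.c n x) = 0) :
    ∃ a k g, D.Assembles a k g ∧ ∀ n x, D.ρ n (a n x) = u n x := by
  choose a ha using fun n => exists_lift_of_free (D.ρ n) (u n) fun x => D.ρ_surj n _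
  choose k hk using fun n => exists_lift_of_free (D.ι n) ((a n).comp (D.c n)) fun x =>
    (D.ρ_eq_zero n _).1 (by simp [ha, hu])
  obtain ⟨g, hg⟩ := exists_shift (X := fun n => C n →+ G n) fun n =>
    (D.π (n + 1)).comp (a (n + 1)) + D.ε • (D.lam n).comp (k n)
  exact ⟨a, k, g, ⟨hk, fun n x => by simp [hg]⟩, ha⟩

theorem coboundary_iff [∀ n, Module.Free ℤ (C n)] {a : ∀ n, C n →+ F n}
    {k : ∀ n, C (n + 1) →+ K n} {g : ∀ n, C n →+ G n} (hag : D.Assembles a k g) :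
    (∀ n, ∃ e : C n →+ H (n + 1), ∀ x, D.ρ (n + 1) (a (n + 1) x) = e (D.c n x)) ↔
      ∃ h : ∀ n, C n →+ G (n + 1), ∀ n x,
        g (n + 1) x = h n (D.c n x) + D.ε • D.b (n + 1) (h (n + 1) x) := by
  constructor
  · intro he
    choose e he using he
    choose e' he' using fun n => exists_lift_of_free (D.ρ (n + 1)) (e n) fun x => D.ρ_surj _ _
    choose l' hl' using fun n => exists_lift_of_free (D.ι (n + 1))
      (a (n + 1) - (e' n).comp (D.c n)) fun x => (D.ρ_eq_zero _ _).1 (by simp [he, he'])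
    obtain ⟨l, hl⟩ := exists_shift (X := fun n => C n →+ K n) l'
    have hlc : ∀ n x, l n (D.c n x) = k n x := by
      intro n x
      obtain ⟨m, rfl⟩ : ∃ m, n = m + 1 := ⟨n - 1, by ring⟩
      exact D.ι_inj _ (by simp [hl, hl', hag.1, D.c_c])
    refine ⟨fun n => (D.π (n + 1)).comp (e' n) + D.ε • (D.lam n).comp (l n), fun n x => ?_⟩
    simp [hlc, hag.2, D.b_π, D.b_lam, D.smul_ε, hl, hl']
    abel
  · rintro ⟨h, hh⟩
    have hk : ∀ n x, k n (D.r (n + 1) x) = 0 := fun n x =>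
      D.ι_inj n (by rw [hag.1, D.c_r, map_zero, map_zero])
    have hπ : ∀ n x, D.π n (a n (D.r n x)) = D.ε • D.b n (h n (D.r n x)) := by
      intro n x
      obtain ⟨m, rfl⟩ : ∃ m, n = m + 1 := ⟨n - 1, by ring⟩
      have := hh m (D.r (m + 1) x)
      rwa [hag.2, hk, D.c_r, map_zero, map_zero, smul_zero, add_zero, zero_add] at this
    intro n
    obtain ⟨l, hl⟩ := exists_lift_of_free (D.ι n) ((a n).comp (D.r n)) fun x =>
      D.exists_ι n _ (D.ε • h n (D.r n x)) (by simp [hπ])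
    simp only [AddMonoidHom.comp_apply] at hl
    obtain ⟨e, he⟩ := exists_lift_of_free (D.π (n + 1))
      ((h n).comp (D.r n) - D.ε • (D.lam n).comp l) fun x => D.exists_π _ _ (by
        rw [D.mem_cyc]
        simp [D.b_lam, hl, hπ, D.smul_ε])
    refine ⟨(D.ρ (n + 1)).comp e, fun x => ?_⟩
    rw [AddMonoidHom.comp_apply, ← sub_eq_zero, ← map_sub, D.ρ_eq_zero]
    have hlc : l (D.c n x) = k n x := D.ι_inj n (by rw [hl, D.r_c, hag.1])
    refine D.exists_ι _ _ (D.ε • h (n + 1) x) ?_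
    have := hh n x
    rw [hag.2] at this
    rw [map_sub, he, map_zsmul, AddMonoidHom.sub_apply, AddMonoidHom.smul_apply,
      AddMonoidHom.comp_apply, AddMonoidHom.comp_apply, D.r_c, hlc, sub_sub_eq_add_sub, this]
    abel

end HomologyResolution

theorem castHom_castHom (F : ℤ → Type*) [∀ n, AddCommGroup (F n)] {a b c : ℤ} (h : a = b)
    (h' : b = c) (x : F a) : castHom F h' (castHom F h x) = castHom F (h.trans h') x := by
  subst h h'
  rfl

theorem castHom_self (F : ℤ → Type*) [∀ n, AddCommGroup (F n)] {a : ℤ} (h : a = a) (x : F a) :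
    castHom F h x = x := rfl

theorem castHom_injective (F : ℤ → Type*) [∀ n, AddCommGroup (F n)] {a b : ℤ} (h : a = b) :
    Function.Injective (castHom F h) := by
  subst h
  exact Function.injective_id

theorem castHom_naturality (F F' : ℤ → Type*) [∀ n, AddCommGroup (F n)]
    [∀ n, AddCommGroup (F' n)] (s : ℤ → ℤ) (f : ∀ n, F n →+ F' (s n)) {a b : ℤ} (h : a = b)
    (x : F a) : f b (castHom F h x) = castHom F' (congrArg s h) (f a x) := by
  subst h
  rfl

theorem castHom_pi_apply (C F : ℤ → Type*) [∀ n, AddCommGroup (C n)] [∀ n, AddCommGroup (F n)]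
    (s : ℤ → ℤ → ℤ) {a b : ℤ} (h : a = b) (f : ∀ n, C n →+ F (s a n)) (n : ℤ) (x : C n) :
    castHom (fun q => ∀ n, C n →+ F (s q n)) h f n x =
      castHom F (congrArg (s · n) h) (f n x) := by
  subst h
  rfl

/-- The differential `C_{n+1} → C_n`. -/
def boundaryMap (C : ℤ → Type*) [∀ n, AddCommGroup (C n)] (dC : ∀ n : ℤ, C n →+ C (n - 1))
    (n : ℤ) : C (n + 1) →+ C n :=
  (castHom C (show n + 1 - 1 = n by ring)).comp (dC (n + 1))

/-- The differential `G_{n+1-p} → G_{n-p}`. -/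
def shiftedBoundaryMap (G : ℤ → Type*) [∀ n, AddCommGroup (G n)]
    (dG : ∀ n : ℤ, G n →+ G (n - 1)) (p n : ℤ) : G (n + 1 - p) →+ G (n - p) :=
  (castHom G (show n + 1 - p - 1 = n - p by ring)).comp (dG (n + 1 - p))

theorem mem_boundariesSub_iff (G : ℤ → Type*) [∀ n, AddCommGroup (G n)]
    (dG : ∀ n : ℤ, G n →+ G (n - 1)) (p n : ℤ) (x : G (n - p)) :
    x ∈ boundariesSub G dG (n - p) ↔ ∃ y, shiftedBoundaryMap G dG p n y = x := by
  have h : n - p + 1 = n + 1 - p := by ring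
  constructor
  · rintro ⟨_, ⟨y, rfl⟩, rfl⟩
    refine ⟨castHom G h y, ?_⟩
    simp only [shiftedBoundaryMap, AddMonoidHom.comp_apply]
    rw [castHom_naturality G G (fun n => n - 1) dG, castHom_castHom]
  · rintro ⟨y, rfl⟩
    refine ⟨_, ⟨castHom G h.symm y, rfl⟩, ?_⟩
    simp only [shiftedBoundaryMap, AddMonoidHom.comp_apply]
    rw [castHom_naturality G G (fun n => n - 1) dG, castHom_castHom]

theorem mem_coboundariesSub_succ_iff (C : ℤ → Type*) [∀ n, AddCommGroup (C n)]
    (dC : ∀ n : ℤ, C n →+ C (n - 1)) (M : Type*) [AddCommGroup M] (n : ℤ) (u : C (n + 1) →+ M) :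
    u ∈ coboundariesSub C dC M (n + 1) ↔
      ∃ e : C n →+ M, ∀ x, u x = e (boundaryMap C dC n x) := by
  have key : ∀ m (h : m + 1 = n + 1),
      u ∈ ((dualD C dC M m).range).map (castHom (fun k => C k →+ M) h) ↔
        ∃ e : C n →+ M, ∀ x, u x = e (boundaryMap C dC n x) := by
    intro m h
    obtain rfl : m = n := by omega
    constructor
    · rintro ⟨_, ⟨e, rfl⟩, rfl⟩
      exact ⟨e, fun x => rfl⟩
    · rintro ⟨e, he⟩
      exact ⟨_, ⟨e, rfl⟩, AddMonoidHom.ext fun x => (he x).symm⟩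
  exact key _ _

theorem castHom_homDelta (C G : ℤ → Type*) [∀ n, AddCommGroup (C n)] [∀ n, AddCommGroup (G n)]
    (dC : ∀ n : ℤ, C n →+ C (n - 1)) (dG : ∀ n : ℤ, G n →+ G (n - 1)) (p : ℤ)
    (f : ∀ n, C n →+ G (n - p)) (n k : ℤ) (h : n + 1 - (p + 1) = k) (x : C (n + 1)) :
    castHom G h (homDelta C G dC dG p f (n + 1) x) =
      castHom G (by omega) (f n (boundaryMap C dC n x)) -
        (p.negOnePow : ℤ) • castHom G (by omega) (dG (n + 1 - p) (f (n + 1) x)) := by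
  simp only [homDelta, boundaryMap, AddMonoidHom.sub_apply, AddMonoidHom.smul_apply,
    AddMonoidHom.comp_apply, map_sub, map_zsmul]
  rw [castHom_naturality C G (fun n => n - p) f, castHom_castHom, castHom_castHom, castHom_castHom]

theorem mem_ker_bigDelta_iff (C G : ℤ → Type*) [∀ n, AddCommGroup (C n)]
    [∀ n, AddCommGroup (G n)] (dC : ∀ n : ℤ, C n →+ C (n - 1))
    (dG : ∀ n : ℤ, G n →+ G (n - 1)) (p : ℤ) (g : ∀ n, C n →+ G (n - p)) :
    g ∈ (bigDelta C G dC dG p).ker ↔ ∀ n x, g n (boundaryMap C dC n x) =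
      (p.negOnePow : ℤ) • shiftedBoundaryMap G dG p n (g (n + 1) x) := by
  have hk : ∀ n x, castHom G (show n + 1 - (p + 1) = n - p by ring)
      (homDelta C G dC dG p g (n + 1) x) = g n (boundaryMap C dC n x) -
        (p.negOnePow : ℤ) • shiftedBoundaryMap G dG p n (g (n + 1) x) := fun n x =>
    castHom_homDelta C G dC dG p g n (n - p) _ x
  constructor
  · intro hg n x
    have hz : homDelta C G dC dG p g = 0 := hg
    rw [← sub_eq_zero, ← hk, hz]
    simp
  · intro hg
    refine funext fun n => AddMonoidHom.ext fun x => ?_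
    obtain ⟨m, rfl⟩ : ∃ m, n = m + 1 := ⟨n - 1, by ring⟩
    apply castHom_injective G (show m + 1 - (p + 1) = m - p by ring)
    exact (hk m x).trans (by simp [hg])

theorem mem_map_range_bigDelta_iff (C G : ℤ → Type*) [∀ n, AddCommGroup (C n)]
    [∀ n, AddCommGroup (G n)] (dC : ∀ n : ℤ, C n →+ C (n - 1))
    (dG : ∀ n : ℤ, G n →+ G (n - 1)) (p : ℤ) (g : ∀ n, C n →+ G (n - p)) :
    g ∈ ((bigDelta C G dC dG (p - 1)).range).map
        (castHom (fun q => ∀ n : ℤ, C n →+ G (n - q)) (show p - 1 + 1 = p by ring)) ↔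
      ∃ h : ∀ n, C n →+ G (n + 1 - p), ∀ n x, g (n + 1) x = h n (boundaryMap C dC n x) +
        (p.negOnePow : ℤ) • shiftedBoundaryMap G dG p (n + 1) (h (n + 1) x) := by
  have hs : ∀ n : ℤ, n - (p - 1) = n + 1 - p := fun n => by ring
  have hp : ((p - 1).negOnePow : ℤ) = - (p.negOnePow : ℤ) := by simp [Int.negOnePow_sub]
  have key : ∀ (f : ∀ n, C n →+ G (n - (p - 1))) n x,
      castHom (fun q => ∀ n : ℤ, C n →+ G (n - q)) (show p - 1 + 1 = p by ring)
        (bigDelta C G dC dG (p - 1) f) (n + 1) x =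
      castHom G (hs n) (f n (boundaryMap C dC n x)) + (p.negOnePow : ℤ) •
        shiftedBoundaryMap G dG p (n + 1) (castHom G (hs (n + 1)) (f (n + 1) x)) := by
    intro f n x
    refine (castHom_pi_apply C G (fun q n => n - q) _ _ _ _).trans ?_
    refine (castHom_homDelta C G dC dG (p - 1) f n _ _ x).trans ?_
    rw [hp, neg_smul, sub_neg_eq_add]
    simp only [shiftedBoundaryMap, AddMonoidHom.comp_apply]
    rw [castHom_naturality G G (fun n => n - 1) dG, castHom_castHom]
  constructor
  · rintro ⟨_, ⟨f, rfl⟩, rfl⟩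
    exact ⟨fun n => (castHom G (hs n)).comp (f n), key f⟩
  · rintro ⟨h, hh⟩
    refine ⟨_, ⟨fun n => (castHom G (hs n).symm).comp (h n), rfl⟩, ?_⟩
    refine funext fun n => AddMonoidHom.ext fun x => ?_
    obtain ⟨m, rfl⟩ : ∃ m, n = m + 1 := ⟨n - 1, by ring⟩
    refine (key _ m x).trans ?_
    simp only [AddMonoidHom.comp_apply, castHom_castHom, castHom_self, hh]

theorem free_addSubgroup {A : Type*} [AddCommGroup A] [Module.Free ℤ A] [Module.Finite ℤ A]
    (S : AddSubgroup A) : Module.Free ℤ S :=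
  inferInstanceAs (Module.Free ℤ (AddSubgroup.toIntSubmodule S))

/-- A homomorphism out of a finitely generated free group admits a retraction onto its kernel. -/
theorem exists_retraction_ker {A B : Type*} [AddCommGroup A] [AddCommGroup B] [Module.Free ℤ B]
    [Module.Finite ℤ B] (d : A →+ B) :
    ∃ r : A →+ A, (∀ x, d (r x) = 0) ∧ ∀ x, d x = 0 → r x = x := by
  have := free_addSubgroup d.range
  obtain ⟨s, hs⟩ := exists_lift_of_free d d.range.subtype fun x => x.2
  refine ⟨AddMonoidHom.id A - s.comp d.rangeRestrict, fun x => ?_, fun x hx => ?_⟩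
  · simp [hs]
  · have : d.rangeRestrict x = 0 := Subtype.ext hx
    simp [this]

section Resolution

variable (G : ℤ → Type*) [∀ n, AddCommGroup (G n)] (dG : ∀ n : ℤ, G n →+ G (n - 1))

/-- The free abelian group on the `n`-cycles. -/
abbrev freeCycles (n : ℤ) : Type _ := ↥(cyclesSub G dG n) →₀ ℤ

/-- The canonical projection of `freeCycles` onto the cycles. -/
def freeCyclesProj (n : ℤ) : freeCycles G dG n →+ ↥(cyclesSub G dG n) :=
  (Finsupp.linearCombination ℤ id).toAddMonoidHom

theorem freeCyclesProj_surjective (n : ℤ) : Function.Surjective (freeCyclesProj G dG n) :=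
  fun x => ⟨Finsupp.single x 1, by simp [freeCyclesProj]⟩

/-- The relations among the generators of `freeCycles` in homology. -/
def freeBoundaries (n : ℤ) : AddSubgroup (freeCycles G dG n) :=
  ((boundariesSub G dG n).addSubgroupOf (cyclesSub G dG n)).comap (freeCyclesProj G dG n)

theorem exists_shiftedBoundaryMap_lift [∀ n, Finite (G n)] (p n : ℤ) :
    ∃ t : freeBoundaries G dG (n - p) →+ G (n + 1 - p),
      ∀ x, shiftedBoundaryMap G dG p n (t x) = freeCyclesProj G dG (n - p) x := by
  have := free_addSubgroup (freeBoundaries G dG (n - p))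
  exact exists_lift_of_free (shiftedBoundaryMap G dG p n)
    (((cyclesSub G dG (n - p)).subtype.comp (freeCyclesProj G dG (n - p))).comp
      (freeBoundaries G dG (n - p)).subtype)
    fun x => (mem_boundariesSub_iff G dG p n _).1 x.2

theorem mem_cyclesSub_succ_iff (p n : ℤ) (x : G (n + 1 - p)) :
    x ∈ cyclesSub G dG (n + 1 - p) ↔ shiftedBoundaryMap G dG p n x = 0 :=
  (map_eq_zero_iff _ (castHom_injective G _)).symm

theorem shiftedBoundaryMap_mem_cyclesSub (hdG : ∀ n : ℤ, (dG (n - 1)).comp (dG n) = 0)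
    (p n : ℤ) (x : G (n + 1 - p)) : shiftedBoundaryMap G dG p n x ∈ cyclesSub G dG (n - p) := by
  change dG (n - p) (castHom G _ (dG (n + 1 - p) x)) = 0
  rw [castHom_naturality G G (fun n => n - 1) dG]
  exact (congrArg _ (DFunLike.congr_fun (hdG (n + 1 - p)) x)).trans (map_zero _)

/-- The resolution of the homology of `G`, in degrees shifted by `p`, by free groups of cycles. -/
def homologyResolution [∀ n, Finite (G n)] (hdG : ∀ n : ℤ, (dG (n - 1)).comp (dG n) = 0) (p : ℤ)
    (C : ℤ → Type*) [∀ n, AddCommGroup (C n)] [∀ n, Module.Free ℤ (C n)]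
    [∀ n, Module.Finite ℤ (C n)] (dC : ∀ n : ℤ, C n →+ C (n - 1))
    (hdC : ∀ n : ℤ, (dC (n - 1)).comp (dC n) = 0) :
    HomologyResolution C (fun n => G (n - p)) (fun n => freeCycles G dG (n - p))
      (fun n => freeBoundaries G dG (n - p)) (fun n => homologyGrp G dG (n - p)) where
  c := boundaryMap C dC
  b := shiftedBoundaryMap G dG p
  cyc n := cyclesSub G dG (n - p)
  r n := (exists_retraction_ker (dC n)).choose
  π n := (cyclesSub G dG (n - p)).subtype.comp (freeCyclesProj G dG (n - p))
  ι n := (freeBoundaries G dG (n - p)).subtype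
  lam n := (exists_shiftedBoundaryMap_lift G dG p n).choose
  ρ n := (homologyProj G dG (n - p)).comp (freeCyclesProj G dG (n - p))
  ε := p.negOnePow
  ε_mul := by simp
  mem_cyc := mem_cyclesSub_succ_iff G dG p
  b_mem := shiftedBoundaryMap_mem_cyclesSub G dG hdG p
  r_c n x := by
    apply (exists_retraction_ker (dC n)).choose_spec.2
    change dC n (castHom C _ (dC (n + 1) x)) = 0
    rw [castHom_naturality C C (fun n => n - 1) dC]
    exact (congrArg _ (DFunLike.congr_fun (hdC (n + 1)) x)).trans (map_zero _)
  c_r n x := (congrArg (castHom C (by ring)) ((exists_retraction_ker (dC (n + 1))).choose_spec.1 x)).trans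
    (map_zero _)
  r_r n x := (exists_retraction_ker (dC n)).choose_spec.2 _
    ((exists_retraction_ker (dC n)).choose_spec.1 x)
  π_mem n x := (freeCyclesProj G dG (n - p) x).2
  exists_π n x hx := (freeCyclesProj_surjective G dG (n - p) ⟨x, hx⟩).imp
    fun _ h => congrArg Subtype.val h
  ι_inj n := Subtype.val_injective
  b_lam n := (exists_shiftedBoundaryMap_lift G dG p n).choose_spec
  exists_ι n f y h := ⟨⟨f, (mem_boundariesSub_iff G dG p n _).2 ⟨y, h.symm⟩⟩, rfl⟩
  ρ_surj n := (QuotientAddGroup.mk'_surjective _).comp (freeCyclesProj_surjective G dG (n - p))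
  ρ_eq_zero n f := (QuotientAddGroup.eq_zero_iff (freeCyclesProj G dG (n - p) f)).trans
    ⟨fun h => ⟨⟨f, h⟩, rfl⟩, by rintro ⟨k, rfl⟩; exact k.2⟩

end Resolution

theorem nonempty_addEquiv_of_ker_eq {T A B : Type*} [AddCommGroup T] [AddCommGroup A]
    [AddCommGroup B] (f : T →+ A) (g : T →+ B) (hf : Function.Surjective f)
    (hg : Function.Surjective g) (h : f.ker = g.ker) : Nonempty (A ≃+ B) :=
  ⟨(QuotientAddGroup.quotientKerEquivOfSurjective f hf).symm.trans
    ((QuotientAddGroup.quotientAddEquivOfEq h).trans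
      (QuotientAddGroup.quotientKerEquivOfSurjective g hg))⟩

/-- Brown's theorem: for every `p ∈ ℤ` there is an isomorphism of abelian
groups `∏_n H^n(C, H_{n-p}(G)) ≅ H^p(C,G)`. -/
theorem brown_isomorphism (C : ℤ → Type*) [∀ n, AddCommGroup (C n)]
    [∀ n, Module.Free ℤ (C n)] [∀ n, Module.Finite ℤ (C n)]
    (dC : ∀ n : ℤ, C n →+ C (n - 1))
    (hdC : ∀ n : ℤ, (dC (n - 1)).comp (dC n) = 0)
    (hCfin : {n : ℤ | Nontrivial (C n)}.Finite)
    (G : ℤ → Type*) [∀ n, AddCommGroup (G n)] [∀ n, Finite (G n)]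
    (dG : ∀ n : ℤ, G n →+ G (n - 1))
    (hdG : ∀ n : ℤ, (dG (n - 1)).comp (dG n) = 0)
    (hGfin : {n : ℤ | Nontrivial (G n)}.Finite)
    (p : ℤ) :
    Nonempty ((∀ n : ℤ, cohomologyGrp C dC (homologyGrp G dG (n - p)) n) ≃+
      homComplexCohomology C G dC dG p) := by
  let D := homologyResolution G dG hdG p C dC hdC
  let T : AddSubgroup ((∀ n, C n →+ freeCycles G dG (n - p)) ×
      (∀ n, C (n + 1) →+ freeBoundaries G dG (n - p)) ×
      (∀ n, cocyclesSub C dC (homologyGrp G dG (n - p)) n) × (bigDelta C G dC dG p).ker) :=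
    { carrier := {t | D.Assembles t.1 t.2.1 t.2.2.2 ∧
        ∀ n x, D.ρ n (t.1 n x) = (t.2.2.1 n : C n →+ _) x}
      zero_mem' := ⟨⟨fun n x => by simp, fun n x => by simp⟩, fun n x => by simp⟩
      add_mem' := fun {s t} hs ht =>
        ⟨⟨fun n x => by simp [hs.1.1, ht.1.1], fun n x => by
          simp [hs.1.2, ht.1.2]
          abel⟩, fun n x => by simp [hs.2, ht.2]⟩
      neg_mem' := fun {t} ht =>
        ⟨⟨fun n x => by simp [ht.1.1], fun n x => by
          simp [ht.1.2]
          abel⟩, fun n x => by simp [ht.2]⟩ }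
  let f : T →+ ∀ n : ℤ, cohomologyGrp C dC (homologyGrp G dG (n - p)) n :=
    { toFun := fun t n => QuotientAddGroup.mk (t.1.2.2.1 n)
      map_zero' := rfl
      map_add' := fun _ _ => rfl }
  let g : T →+ homComplexCohomology C G dC dG p :=
    { toFun := fun t => QuotientAddGroup.mk t.1.2.2.2
      map_zero' := rfl
      map_add' := fun _ _ => rfl }
  refine nonempty_addEquiv_of_ker_eq f g ?_ ?_ ?_
  · intro y
    choose u hu using fun n => QuotientAddGroup.mk_surjective (y n)
    obtain ⟨a, k, w, h, ha⟩ := D.exists_assembles_of_comp_eq_zero (fun n => (u n).1)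
      fun n x => DFunLike.congr_fun (u n).2 x
    exact ⟨⟨(a, k, u, ⟨w, (mem_ker_bigDelta_iff C G dC dG p w).2 h.isCocycle⟩), h, ha⟩,
      funext hu⟩
  · intro y
    obtain ⟨w, rfl⟩ := QuotientAddGroup.mk_surjective y
    obtain ⟨a, k, h⟩ := D.exists_assembles_of_isCocycle
      ((mem_ker_bigDelta_iff C G dC dG p w).1 w.2)
    refine ⟨⟨(a, k, fun n => ⟨(D.ρ n).comp (a n), AddMonoidHom.ext fun x => ?_⟩, w), h,
      fun n x => rfl⟩, rfl⟩
    exact (D.ρ_eq_zero n _).2 ⟨k n x, h.1 n x⟩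
  · ext ⟨⟨a, k, u, w⟩, h, hu⟩
    have hf : f ⟨⟨a, k, u, w⟩, h, hu⟩ = 0 ↔ ∀ n, ∃ e : C n →+ homologyGrp G dG (n + 1 - p),
        ∀ x, D.ρ (n + 1) (a (n + 1) x) = e (D.c n x) := by
      have hn : ∀ n, (∃ e : C n →+ homologyGrp G dG (n + 1 - p),
          ∀ x, D.ρ (n + 1) (a (n + 1) x) = e (D.c n x)) ↔
          (QuotientAddGroup.mk (u (n + 1)) :
            cohomologyGrp C dC (homologyGrp G dG (n + 1 - p)) (n + 1)) = 0 := by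
        intro n
        rw [QuotientAddGroup.eq_zero_iff, AddSubgroup.mem_addSubgroupOf,
          mem_coboundariesSub_succ_iff]
        simp only [← hu]
        rfl
      simp only [hn]
      refine ⟨fun h n => congrFun h (n + 1), fun h => funext fun n => ?_⟩
      obtain ⟨m, rfl⟩ : ∃ m, n = m + 1 := ⟨n - 1, by ring⟩
      exact h m
    have hg : g ⟨⟨a, k, u, w⟩, h, hu⟩ = 0 ↔ ∃ h : ∀ n, C n →+ G (n + 1 - p), ∀ n x,
        (w : ∀ n, C n →+ G (n - p)) (n + 1) x =
          h n (D.c n x) + D.ε • D.b (n + 1) (h (n + 1) x) :=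
      (QuotientAddGroup.eq_zero_iff w).trans (mem_map_range_bigDelta_iff C G dC dG p w)
    rw [AddMonoidHom.mem_ker, AddMonoidHom.mem_ker, hf, hg]
    exact D.coboundary_iff h
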